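/- Let G be a finite connected simple graph that admits a star spanning tree T_s with center v, and let T be a spanning tree of G with no interbranch cycle-edges (Δ_T = ∅) such that ∩(T) < ∩(T_s). Then there exists a neighbor w of v in T (rooted at v) such that ∩(T_w) < ∩(G_w ∧ T_s), where T_w is the principal subtree with respect to w, G_w is the subgraph of G spanned by T_w, and G_w ∧ T_s is the intersection of G_w with T_s (the subtree of T_s restricted to G_w). -/

import Mathlib

open SimpleGraph

/-- The set of edges lying on some path (in a tree: the unique path) between `x` and `y`
in the graph `T`. -/
def pathEdges {V : Type*} (T : SimpleGraph V) (x y : V) : Set (Sym2 V) :=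
  {f | ∃ p : T.Walk x y, p.IsPath ∧ f ∈ p.edges}

/-- The edge set of the tree-cycle induced (in the spanning tree `T`) by the cycle-edge `e`:
the edge `e` itself together with the edges of the (unique) path in `T` between
the endpoints of `e`. -/
def cycEdges {V : Type*} (T : SimpleGraph V) (e : Sym2 V) : Set (Sym2 V) :=
  insert e {f | ∃ x y, e = s(x, y) ∧ f ∈ pathEdges T x y}

/-- The vertex set of the tree-cycle induced (in the spanning tree `T`) by the
cycle-edge `e`. -/
def cycVerts {V : Type*} (T : SimpleGraph V) (e : Sym2 V) : Set V :=
  {v | ∃ x y, e = s(x, y) ∧ ∃ p : T.Walk x y, p.IsPath ∧ v ∈ p.support}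

/-- Two tree-cycles (induced by the cycle-edges `e` and `f`) have non-empty intersection:
some edge of `T` belongs to both of them. -/
def cyclesIntersect {V : Type*} (T : SimpleGraph V) (e f : Sym2 V) : Prop :=
  (cycEdges T e ∩ cycEdges T f ∩ T.edgeSet).Nonempty

/-- The cycle intersection number `∩_T(c)` of the tree-cycle `c` induced by the
cycle-edge `e`: the number of tree-cycles distinct from `c` whose intersection with `c`
is non-empty. -/
noncomputable def cycleInterNum {V : Type*} (G T : SimpleGraph V) (e : Sym2 V) : ℕ :=
  {f | f ∈ G.edgeSet \ T.edgeSet ∧ f ≠ e ∧ cyclesIntersect T e f}.ncard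

/-- The tree intersection number `∩_G(T)`: the number of unordered pairs of distinct
tree-cycles of `T` whose intersection is non-empty. -/
noncomputable def treeInterNum {V : Type*} (G T : SimpleGraph V) : ℕ :=
  {p : Sym2 (Sym2 V) | ∃ e f : Sym2 V, p = s(e, f) ∧ e ≠ f ∧
    e ∈ G.edgeSet \ T.edgeSet ∧ f ∈ G.edgeSet \ T.edgeSet ∧ cyclesIntersect T e f}.ncard

/-- `T` is a star spanning tree of `G` with center `v`. -/
def IsStarSpanningTree {V : Type*} (G T : SimpleGraph V) (v : V) : Prop :=
  T ≤ G ∧ T.IsTree ∧ ∀ u, u ≠ v → T.Adj v u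

/-- `closest-point-set(w, c)`: the set of vertices outside the tree-cycle `c` (induced by
the cycle-edge `e`) whose closest point on `c` (with respect to distance in `T`) is `w`. -/
def closestPointSet {V : Type*} (T : SimpleGraph V) (e : Sym2 V) (w : V) : Set V :=
  {v | v ∉ cycVerts T e ∧ ∀ u ∈ cycVerts T e, T.dist v w ≤ T.dist v u}

/-- The set of interbranch cycle-edges of the spanning tree `T` (relative to the center
`v` of a star spanning tree): cycle-edges `e = (u, w)` such that the closest point of
`v` on the tree-cycle induced by `e` is neither `u` nor `w`. -/
def interbranchSet {V : Type*} (G T : SimpleGraph V) (v : V) : Set (Sym2 V) :=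
  {e | e ∈ G.edgeSet \ T.edgeSet ∧
    ∀ w ∈ cycVerts T e, (∀ u ∈ cycVerts T e, T.dist v w ≤ T.dist v u) → w ∉ e}

/-- Vertex set of the principal subtree of the rooted tree `(T, v)` with respect to the
neighbor `w` of `v`: the vertex `v` together with all vertices `u` such that `w` lies on
the (unique) path in `T` from `v` to `u`. -/
def branchVerts {V : Type*} (T : SimpleGraph V) (v w : V) : Set V :=
  insert v {u | ∃ p : T.Walk v u, p.IsPath ∧ w ∈ p.support}

/-- The subgraph of `G` spanned by the vertex set `s` (on the same ambient vertex type):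
all edges of `G` with both endpoints in `s`. -/
def spannedSubgraph {V : Type*} (G : SimpleGraph V) (s : Set V) : SimpleGraph V :=
  SimpleGraph.fromEdgeSet {f | f ∈ G.edgeSet ∧ ∀ x ∈ f, x ∈ s}

theorem cnt_aux {ι α : Type*} [Finite α] [Finite ι] (A B : ι → Set α) (P Q : Set α)
    (hA : ∀ i, A i ⊆ P) (hd : ∀ i j, i ≠ j → Disjoint (A i) (A j))
    (hB : ∀ q ∈ Q, ∃ i, q ∈ B i) (h : ∀ i, (B i).ncard ≤ (A i).ncard) :
    Q.ncard ≤ P.ncard := by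
  classical
  have := Fintype.ofFinite α
  have := Fintype.ofFinite ι
  simp only [Set.ncard_eq_toFinset_card'] at *
  calc Q.toFinset.card ≤ (Finset.univ.biUnion fun i => (B i).toFinset).card := by
        apply Finset.card_le_card
        intro q hq
        simpa using hB q (by simpa using hq)
    _ ≤ ∑ i, (B i).toFinset.card := Finset.card_biUnion_le
    _ ≤ ∑ i, (A i).toFinset.card := Finset.sum_le_sum fun i _ => h i
    _ = (Finset.univ.biUnion fun i => (A i).toFinset).card := by
        rw [Finset.card_biUnion]
        intro i _ j _ hij
        simpa using hd i j hij
    _ ≤ P.toFinset.card := by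
        apply Finset.card_le_card
        intro q hq
        simp only [Finset.mem_biUnion, Finset.mem_univ, true_and, Set.mem_toFinset] at hq
        obtain ⟨i, hi⟩ := hq
        simpa using hA i hi

theorem first_step {V : Type*} {T : SimpleGraph V} (hT : T.IsAcyclic) {v x w : V}
    (p : T.Walk v x) (hp : p.IsPath) (hw : w ∈ p.support) (hvw : T.Adj v w) :
    p.snd = w := by
  classical
  cases p with
  | nil => simp at hw; exact absurd hw hvw.ne'
  | @cons _ u _ h q =>
    have hwq : w ∈ q.support := by
      simp only [Walk.support_cons, List.mem_cons] at hw
      rcases hw with hw | hw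
      · exact absurd hw hvw.ne'
      · exact hw
    rw [Walk.cons_isPath_iff] at hp
    have h1 : (Walk.cons h (q.takeUntil w hwq)).IsPath := by
      rw [Walk.cons_isPath_iff]
      exact ⟨hp.1.takeUntil hwq, fun hh => hp.2 (q.support_takeUntil_subset hwq hh)⟩
    have h2 : (Walk.cons hvw Walk.nil).IsPath := by
      simp [hvw.ne]
    have h3 := congrArg Subtype.val (hT.path_unique ⟨_, h1⟩ ⟨_, h2⟩)
    have h4 := congrArg Walk.snd h3
    simpa using h4

theorem snd_mem_take {V : Type*} [DecidableEq V] {T : SimpleGraph V} {v x y : V}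
    (q : T.Walk v y) (hx : x ∈ q.support) (hxv : x ≠ v) :
    q.snd ∈ (q.takeUntil x hx).support := by
  rw [← Walk.snd_takeUntil hxv q hx]
  exact Walk.getVert_mem_support _ _

theorem branch_anc {V : Type*} {T : SimpleGraph V} (hT : T.IsAcyclic) {v x y w : V}
    (hvw : T.Adj v w) (hxv : x ≠ v)
    (q : T.Walk v y) (hq : q.IsPath) (hx : x ∈ q.support) :
    x ∈ branchVerts T v w ↔ y ∈ branchVerts T v w := by
  classical
  have hyv : y ≠ v := by
    rintro rfl
    rw [Walk.isPath_iff_nil] at hq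
    rw [Walk.nil_iff_support_eq.1 hq] at hx
    simp at hx; exact hxv hx
  simp only [branchVerts, Set.mem_insert_iff, hxv, hyv, false_or, Set.mem_setOf_eq]
  constructor
  · rintro ⟨p, hp, hw⟩
    refine ⟨q, hq, ?_⟩
    have : p = q.takeUntil x hx :=
      congrArg Subtype.val (hT.path_unique ⟨_, hp⟩ ⟨_, hq.takeUntil hx⟩)
    subst this
    exact q.support_takeUntil_subset hx hw
  · rintro ⟨p, hp, hw⟩
    have : p = q := congrArg Subtype.val (hT.path_unique ⟨_, hp⟩ ⟨_, hq⟩)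
    subst this
    refine ⟨p.takeUntil x hx, hp.takeUntil hx, ?_⟩
    rw [← first_step hT p hp hw hvw]
    exact snd_mem_take p hx hxv

theorem branch_inter {V : Type*} {T : SimpleGraph V} (hT : T.IsAcyclic) {v x w w' : V}
    (hvw : T.Adj v w) (hvw' : T.Adj v w') (hx : x ∈ branchVerts T v w)
    (hx' : x ∈ branchVerts T v w') (hxv : x ≠ v) : w = w' := by
  simp only [branchVerts, Set.mem_insert_iff, hxv, false_or, Set.mem_setOf_eq] at hx hx'
  obtain ⟨p, hp, hw⟩ := hx
  obtain ⟨q, hq, hw'⟩ := hx'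
  have : p = q := congrArg Subtype.val (hT.path_unique ⟨_, hp⟩ ⟨_, hq⟩)
  subst this
  rw [← first_step hT p hp hw hvw, first_step hT p hp hw' hvw']

theorem exists_branch {V : Type*} {T : SimpleGraph V} (hT : T.IsTree) {v x : V}
    (hxv : x ≠ v) : ∃ w, T.Adj v w ∧ x ∈ branchVerts T v w := by
  obtain ⟨p, hp⟩ := (hT.1.preconnected v x).exists_isPath
  have hn : ¬ p.Nil := Walk.not_nil_of_ne hxv.symm
  exact ⟨p.snd, p.adj_snd hn, Or.inr ⟨p, hp, Walk.getVert_mem_support _ _⟩⟩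

/-- If `x` is a closest point to `v` on the path from `x` to `y`, then `x` is an ancestor. -/
theorem anc_of_closest {V : Type*} {T : SimpleGraph V} (hT : T.IsTree) {v x y : V}
    (q : T.Walk x y) (hq : q.IsPath)
    (hc : ∀ u ∈ q.support, T.dist v x ≤ T.dist v u) :
    ∃ p : T.Walk v y, p.IsPath ∧ x ∈ p.support := by
  classical
  obtain ⟨p, hp, hpl⟩ := hT.1.exists_path_of_dist v x
  refine ⟨p.append q, ?_, by simp⟩
  rw [Walk.isPath_def, Walk.support_append, List.nodup_append]
  refine ⟨hp.support_nodup, hq.support_nodup.tail, ?_⟩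
  rintro a ha b hb rfl
  have h1 := hc a (List.mem_of_mem_tail hb)
  have hax : a ≠ x := by
    rintro rfl
    have := hq.support_nodup
    rw [Walk.support_eq_cons] at this
    exact (List.nodup_cons.1 this).1 hb
  have h2 := Walk.length_takeUntil_lt ha hax
  have h3 := SimpleGraph.dist_le (p.takeUntil a ha)
  omega

theorem edge_anc {V : Type*} {G T : SimpleGraph V} (hT : T.IsTree) {v : V}
    (hib : interbranchSet G T v = ∅) {x y : V} (h : G.Adj x y) :
    (∃ p : T.Walk v y, p.IsPath ∧ x ∈ p.support) ∨
    (∃ p : T.Walk v x, p.IsPath ∧ y ∈ p.support) := by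
  classical
  by_cases ht : T.Adj x y
  · obtain ⟨p, hp⟩ := (hT.1.preconnected v x).exists_isPath
    by_cases hy : y ∈ p.support
    · exact Or.inr ⟨p, hp, hy⟩
    · exact Or.inl ⟨p.concat ht, hp.concat hy ht, by simp [Walk.support_concat]⟩
  · have h1 : s(x, y) ∉ interbranchSet G T v := by simp [hib]
    simp only [interbranchSet, Set.mem_setOf_eq, not_and, not_forall, Set.mem_diff,
      mem_edgeSet] at h1
    obtain ⟨c, hc, hcl, hce⟩ := h1 ⟨h, ht⟩
    rw [not_not, Sym2.mem_iff] at hce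
    obtain ⟨q, hq⟩ := (hT.1.preconnected x y).exists_isPath
    rcases hce with rfl | rfl
    · exact Or.inl (anc_of_closest hT q hq fun u hu => hcl u ⟨_, _, rfl, q, hq, hu⟩)
    · exact Or.inr (anc_of_closest hT q.reverse hq.reverse
        fun u hu => hcl u ⟨_, _, rfl, q, hq, by simpa using hu⟩)

theorem edge_branch {V : Type*} {G T : SimpleGraph V} (hT : T.IsTree) {v : V}
    (hib : interbranchSet G T v = ∅) {x y w : V} (h : G.Adj x y) (hvw : T.Adj v w)
    (hxv : x ≠ v) (hyv : y ≠ v) (hx : x ∈ branchVerts T v w) : y ∈ branchVerts T v w := by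
  rcases edge_anc hT hib h with ⟨p, hp, hm⟩ | ⟨p, hp, hm⟩
  · exact (branch_anc hT.2 hvw hxv p hp hm).1 hx
  · exact (branch_anc hT.2 hvw hyv p hp hm).2 hx

theorem spanned_adj {V : Type*} (G : SimpleGraph V) (s : Set V) (x y : V) :
    (spannedSubgraph G s).Adj x y ↔ G.Adj x y ∧ x ∈ s ∧ y ∈ s := by
  simp only [spannedSubgraph, fromEdgeSet_adj, Set.mem_setOf_eq, mem_edgeSet, Sym2.mem_iff,
    forall_eq_or_imp, forall_eq]
  constructor
  · tauto
  · intro h; exact ⟨h, h.1.ne⟩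

theorem spanned_edge {V : Type*} (G : SimpleGraph V) (s : Set V) (e : Sym2 V) :
    e ∈ (spannedSubgraph G s).edgeSet ↔ e ∈ G.edgeSet ∧ ∀ x ∈ e, x ∈ s := by
  induction e with
  | _ x y => simp [spanned_adj]

theorem cyc_mono {V : Type*} {T T' : SimpleGraph V} (h : T ≤ T') (e f : Sym2 V)
    (hi : cyclesIntersect T e f) : cyclesIntersect T' e f := by
  have key : ∀ e, cycEdges T e ⊆ cycEdges T' e := by
    intro e g hg
    rcases hg with hg | ⟨x, y, he, p, hp, hgp⟩
    · exact Or.inl hg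
    · exact Or.inr ⟨x, y, he, p.mapLe h, hp.mapLe h, by simpa using hgp⟩
  obtain ⟨g, ⟨h1, h2⟩, h3⟩ := hi
  exact ⟨g, ⟨key _ h1, key _ h2⟩, edgeSet_mono h h3⟩

/-- Structure of tree-cycles of a star. -/
theorem star_cyc {V : Type*} {T : SimpleGraph V} (hT : T.IsAcyclic) {v : V}
    (hs : ∀ u, u ≠ v → T.Adj v u) {e g : Sym2 V} (he : e ∉ T.edgeSet) (hed : ¬ e.IsDiag)
    (hg : g ∈ T.edgeSet) (hge : g ∈ cycEdges T e) :
    ∃ a b, a ≠ v ∧ b ≠ v ∧ e = s(a, b) ∧ g = s(v, a) := by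
  rcases hge with rfl | ⟨x, y, rfl, p, hp, hgp⟩
  · exact absurd hg he
  have hxv : x ≠ v := by
    rintro rfl
    exact he (hs y (by rintro rfl; simp at hed))
  have hyv : y ≠ v := by
    rintro rfl
    exact he (hs x (by rintro rfl; simp at hed)).symm
  have hxy : x ≠ y := by simpa using hed
  have hq : (Walk.cons (hs x hxv).symm (Walk.cons (hs y hyv) Walk.nil)).IsPath := by
    simp [hxv, hxy, hyv.symm]
  have := congrArg Subtype.val (hT.path_unique ⟨_, hp⟩ ⟨_, hq⟩)
  simp only at this
  subst this
  simp only [Walk.edges_cons, Walk.edges_nil, List.mem_cons, List.not_mem_nil, or_false] at hgp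
  rcases hgp with rfl | rfl
  · exact ⟨x, y, hxv, hyv, rfl, Sym2.eq_swap⟩
  · exact ⟨y, x, hyv, hxv, Sym2.eq_swap, rfl⟩

theorem star_cyc_mem {V : Type*} {T : SimpleGraph V} {v a b : V} (hab : a ≠ b)
    (ha : T.Adj v a) (hb : T.Adj v b) : s(v, a) ∈ cycEdges T s(a, b) := by
  refine Or.inr ⟨a, b, rfl, Walk.cons ha.symm (Walk.cons hb Walk.nil), ?_, ?_⟩
  · simp [ha.ne', hab, hb.ne]
  · simp

/-- If a connected graph `G` admits a star spanning tree `T_s` with center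
`v`, and `T` is a spanning tree with no interbranch cycle-edges (`Δ_T = ∅`) such that
`∩(T) < ∩(T_s)`, then there is a neighbor `w` of `v` in `T` (rooted at `v`) with
`∩(T_w) < ∩(G_w ∧ T_s)`, where `T_w` is the principal subtree with respect to `w`,
`G_w` is the subgraph of `G` spanned by `T_w`, and `G_w ∧ T_s` is the intersection of
`G_w` with `T_s` (the subtree of `T_s` restricted to `G_w`). -/
theorem stmt_19 {V : Type*} [Fintype V] (G Ts T : SimpleGraph V)
    (hG : G.Connected) (v : V) (hTs : IsStarSpanningTree G Ts v)
    (hle : T ≤ G) (hT : T.IsTree)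
    (hib : interbranchSet G T v = ∅)
    (hlt : treeInterNum G T < treeInterNum G Ts) :
    ∃ w ∈ T.neighborSet v,
      treeInterNum (spannedSubgraph G (branchVerts T v w))
          (spannedSubgraph T (branchVerts T v w))
        < treeInterNum (spannedSubgraph G (branchVerts T v w))
            (Ts ⊓ spannedSubgraph G (branchVerts T v w)) := by
  by_contra hcon
  push Not at hcon
  refine absurd hlt (not_lt.2 ?_)
  obtain ⟨hTsG, hTsT, hstar⟩ := hTs
  unfold treeInterNum at hcon ⊢
  refine cnt_aux (ι := {w // T.Adj v w}) _ _ _ _ ?_ ?_ ?_ (fun i => hcon i.1 i.2)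
  · rintro ⟨w, hw⟩ p ⟨e, f, rfl, hne, he, hf, hi⟩
    have key : ∀ e, e ∈ (spannedSubgraph G (branchVerts T v w)).edgeSet \
        (spannedSubgraph T (branchVerts T v w)).edgeSet → e ∈ G.edgeSet \ T.edgeSet := by
      rintro e ⟨h1, h2⟩
      rw [spanned_edge] at h1 h2
      exact ⟨h1.1, fun h => h2 ⟨h, h1.2⟩⟩
    refine ⟨e, f, rfl, hne, key e he, key f hf, cyc_mono ?_ e f hi⟩
    intro x y h
    exact ((spanned_adj _ _ _ _).1 h).1
  · rintro ⟨w, hw⟩ ⟨w', hw'⟩ hww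
    rw [Set.disjoint_left]
    rintro p ⟨e, f, rfl, -, ⟨he, -⟩, -, -⟩ ⟨e', f', hp, -, ⟨he', -⟩, ⟨hf', -⟩, -⟩
    have h2 : e ∈ (spannedSubgraph G (branchVerts T v w')).edgeSet := by
      rcases Sym2.eq_iff.1 hp with ⟨rfl, rfl⟩ | ⟨rfl, rfl⟩ <;> assumption
    apply hww
    apply Subtype.ext
    clear he' hf' hp
    induction e with
    | _ x y =>
      rw [mem_edgeSet, spanned_adj] at he h2
      by_cases hx : x = v
      · exact branch_inter hT.2 hw hw' he.2.2 h2.2.2 (by rintro rfl; exact he.1.ne hx)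
      · exact branch_inter hT.2 hw hw' he.2.1 h2.2.1 hx
  · rintro p ⟨e, f, rfl, hne, he, hf, g, ⟨hge, hgf⟩, hg⟩
    obtain ⟨a, b, hav, hbv, rfl, rfl⟩ :=
      star_cyc hTsT.2 hstar he.2 (G.not_isDiag_of_mem_edgeSet he.1) hg hge
    obtain ⟨a', c, hav', hcv, rfl, haa⟩ :=
      star_cyc hTsT.2 hstar hf.2 (G.not_isDiag_of_mem_edgeSet hf.1) hg hgf
    have : a = a' := by simpa [hav] using haa
    subst this
    obtain ⟨w, hw, haw⟩ := exists_branch hT hav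
    have hvw : v ∈ branchVerts T v w := Or.inl rfl
    have hbw := edge_branch hT hib he.1 hw hav hbv haw
    have hcw := edge_branch hT hib hf.1 hw hav hcv haw
    have hadj : ∀ u, u ≠ v → u ∈ branchVerts T v w →
        (Ts ⊓ spannedSubgraph G (branchVerts T v w)).Adj v u := fun u hu hub =>
      ⟨hstar u hu, (spanned_adj _ _ _ _).2 ⟨hTsG (hstar u hu), hvw, hub⟩⟩
    refine ⟨⟨w, hw⟩, s(a, b), s(a, c), rfl, hne, ⟨?_, ?_⟩, ⟨?_, ?_⟩, s(v, a), ⟨?_, ?_⟩, ?_⟩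
    · exact (spanned_adj _ _ _ _).2 ⟨he.1, haw, hbw⟩
    · exact fun h => he.2 h.1
    · exact (spanned_adj _ _ _ _).2 ⟨hf.1, haw, hcw⟩
    · exact fun h => hf.2 h.1
    · exact star_cyc_mem (G.ne_of_adj he.1) (hadj a hav haw) (hadj b hbv hbw)
    · exact star_cyc_mem (G.ne_of_adj hf.1) (hadj a hav haw) (hadj c hcv hcw)
    · exact hadj a hav haw
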